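/- Let (X,d,μ) and (X',d',μ') be metric measure spaces with X, X' compact, of diameters D_X, D_{X'}, and let p ≥ 1. For every metric coupling δ and probabilistic coupling h, the product correspondence Ŝ_δ = S_δ × S_δ between Obs_c(μ) × Obs_c(μ) and Obs_c(μ') × Obs_c(μ') satisfies: dis(Ŝ_δ) ≤ 4 (∫_{X×X'} δ^p dh)^{1/p} with respect to the max product pseudometrics built from d_{p,μ} and d_{p,μ'}, and fdis(Ŝ_δ) ≤ 2 (D_X + D_{X'}) (∫_{X×X'} δ^p dh)^{1/p} with respect to the functions Σ_μ and Σ_{μ'}. Consequently (1/2) max{dis(Ŝ_δ), 2 fdis(Ŝ_δ)} ≤ max{2, 2(D_X + D_{X'})} (∫_{X×X'} δ^p dh)^{1/p}, so the Gromov–Hausdorff distance between (Obs_c(μ)², Σ_μ) and (Obs_c(μ')², Σ_{μ'}) is at most max{2, 2(D_X + D_{X'})} times the Kantorovich–Sturm p-distance of (X,d,μ) and (X',d',μ'). -/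

import Mathlib

open MeasureTheory Metric

/-- The support of a measure: points all of whose neighborhoods have positive measure. -/
def msupport {X : Type*} [TopologicalSpace X] [MeasurableSpace X] (μ : Measure X) : Set X :=
  {x : X | ∀ U ∈ nhds x, 0 < μ U}

/-- `δ` is a metric coupling of `(X,d,μ)` and `(X',d',μ')`. -/
def MetricCoupling {X X' : Type*} [MetricSpace X] [MetricSpace X']
    [MeasurableSpace X] [MeasurableSpace X']
    (μ : Measure X) (μ' : Measure X') (δ : X ⊕ X' → X ⊕ X' → ℝ) : Prop :=
  (∀ z, δ z z = 0) ∧ (∀ z w, δ z w = δ w z) ∧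
  (∀ z w u, δ z u ≤ δ z w + δ w u) ∧ (∀ z w, δ z w = 0 → z = w) ∧
  (∀ x ∈ msupport μ, ∀ y ∈ msupport μ, δ (Sum.inl x) (Sum.inl y) = dist x y) ∧
  (∀ x ∈ msupport μ', ∀ y ∈ msupport μ', δ (Sum.inr x) (Sum.inr y) = dist x y)

/-- The function `f ⊔ f'` on `K ⊔ K'` is 1-Lipschitz with respect to `δ`. -/
def SqcupLipschitz {X X' : Type*} (K : Set X) (K' : Set X')
    (δ : X ⊕ X' → X ⊕ X' → ℝ) (f : X → ℝ) (f' : X' → ℝ) : Prop :=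
  ∀ z ∈ Sum.inl '' K ∪ Sum.inr '' K', ∀ w ∈ Sum.inl '' K ∪ Sum.inr '' K',
    |Sum.elim f f' z - Sum.elim f f' w| ≤ δ z w

/-- Structural distortion of a relation between two pseudometric spaces
(with pseudometrics given as real-valued functions), valued in `ℝ≥0∞`. -/
noncomputable def relDistortion {α β : Type*} (D : α → α → ℝ) (D' : β → β → ℝ)
    (R : Set (α × β)) : ENNReal :=
  ⨆ q ∈ R, ⨆ r ∈ R, ENNReal.ofReal |D q.1 r.1 - D' q.2 r.2|

/-- Functional distortion of a relation with respect to real-valued functions. -/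
noncomputable def relFunDistortion {α β : Type*} (φ : α → ℝ) (ψ : β → ℝ)
    (R : Set (α × β)) : ENNReal :=
  ⨆ q ∈ R, ENNReal.ofReal |φ q.1 - ψ q.2|

/-- A correspondence: a relation whose projections are both surjective. -/
def IsCorrespondence {α β : Type*} (R : Set (α × β)) : Prop :=
  (∀ a, ∃ b, (a, b) ∈ R) ∧ (∀ b, ∃ a, (a, b) ∈ R)

/-- The Gromov–Hausdorff distance between functional pseudometric spaces
`(α, D, φ)` and `(β, D', ψ)`: `(1/2) inf_R max{dis(R), 2 fdis(R)}` over
correspondences `R`. -/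
noncomputable def funGH {α β : Type*} (D : α → α → ℝ) (D' : β → β → ℝ)
    (φ : α → ℝ) (ψ : β → ℝ) : ENNReal :=
  (1 / 2) * ⨅ R ∈ {R : Set (α × β) | IsCorrespondence R},
    max (relDistortion D D' R) (2 * relFunDistortion φ ψ R)

/-- The Kantorovich–Sturm `p`-distance: the infimum over metric couplings `δ` and
probabilistic couplings `h` of `(∫ δ^p dh)^{1/p}`. -/
noncomputable def dKS {X X' : Type*} [MetricSpace X] [MetricSpace X']
    [MeasurableSpace X] [MeasurableSpace X']
    (μ : Measure X) (μ' : Measure X') (p : ℝ) : ENNReal :=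
  ⨅ δ ∈ {δ : X ⊕ X' → X ⊕ X' → ℝ | MetricCoupling μ μ' δ},
    ⨅ h ∈ {h : Measure (X × X') | IsProbabilityMeasure h ∧
        h.map Prod.fst = μ ∧ h.map Prod.snd = μ'},
      ENNReal.ofReal ((∫ q : X × X', δ (Sum.inl q.1) (Sum.inr q.2) ^ p ∂h) ^ (1 / p))

/-- The `L_p` pseudometric `d_{p,μ}(f,g) = (∫ |f-g|^p dμ)^{1/p}`. -/
noncomputable def dLp {X : Type*} [MeasurableSpace X] (μ : Measure X) (p : ℝ)
    (f g : X → ℝ) : ℝ :=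
  (∫ x, |f x - g x| ^ p ∂μ) ^ (1 / p)

/-- The relation `S_δ` of centered pairs induced by a metric coupling `δ`. -/
def Sdelta {X X' : Type*} [MetricSpace X] [MetricSpace X']
    [MeasurableSpace X] [MeasurableSpace X']
    (μ : Measure X) (μ' : Measure X') (δ : X ⊕ X' → X ⊕ X' → ℝ) :
    Set ((X → ℝ) × (X' → ℝ)) :=
  {q | ∃ (f : X → ℝ) (f' : X' → ℝ), LipschitzWith 1 f ∧ LipschitzWith 1 f' ∧
    SqcupLipschitz (msupport μ) (msupport μ') δ f f' ∧
    q.1 = (fun x => f x - ∫ y, f y ∂μ) ∧ q.2 = (fun x => f' x - ∫ y, f' y ∂μ')}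

/-- The μ-centered metric observables. -/
abbrev Obsc (X : Type*) [MetricSpace X] [MeasurableSpace X] (μ : Measure X) :=
  {F : X → ℝ // LipschitzWith 1 F ∧ ∫ x, F x ∂μ = 0}

section LpNorm

variable {Ω : Type*} [MeasurableSpace Ω] {ν : Measure Ω}

lemma lpNorm_mono_ae_real {P : ENNReal} {f g : Ω → ℝ} (hg : MemLp g P ν)
    (h : ∀ᵐ x ∂ν, |f x| ≤ g x) : lpNorm f P ν ≤ lpNorm g P ν := by
  by_cases hf : AEStronglyMeasurable f ν
  · rw [← toReal_eLpNorm hf, ← toReal_eLpNorm hg.aestronglyMeasurable]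
    exact ENNReal.toReal_mono hg.eLpNorm_ne_top (eLpNorm_mono_ae_real h)
  · simp [lpNorm_of_not_aestronglyMeasurable hf]

lemma integral_abs_le_lpNorm [IsProbabilityMeasure ν] {P : ENNReal} (hP : 1 ≤ P) {f : Ω → ℝ}
    (hf : MemLp f P ν) : ∫ x, |f x| ∂ν ≤ lpNorm f P ν := by
  have h1 := lpNorm_one_eq_integral_norm hf.aestronglyMeasurable
  simp only [Real.norm_eq_abs] at h1
  rw [← h1, ← toReal_eLpNorm hf.aestronglyMeasurable, ← toReal_eLpNorm hf.aestronglyMeasurable]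
  exact ENNReal.toReal_mono hf.eLpNorm_ne_top
    (eLpNorm_le_eLpNorm_of_exponent_le hP hf.aestronglyMeasurable)

lemma lpNorm_sub_integral_le [IsProbabilityMeasure ν] {P : ENNReal} (hP : 1 ≤ P) {f : Ω → ℝ}
    (hf : MemLp f P ν) : lpNorm (fun x => f x - ∫ y, f y ∂ν) P ν ≤ 2 * lpNorm f P ν := by
  have h1 := lpNorm_sub_le hf hP (g := fun _ => ∫ y, f y ∂ν)
  have h2 : lpNorm (fun _ : Ω => ∫ y, f y ∂ν) P ν = |∫ y, f y ∂ν| := by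
    rw [lpNorm_const (by positivity) (IsProbabilityMeasure.ne_zero ν)]
    simp
  have h3 : |∫ y, f y ∂ν| ≤ lpNorm f P ν :=
    abs_integral_le_integral_abs.trans (integral_abs_le_lpNorm hP hf)
  calc _ ≤ lpNorm f P ν + lpNorm (fun _ : Ω => ∫ y, f y ∂ν) P ν := h1
    _ ≤ _ := by linarith

lemma integral_abs_rpow_eq_lpNorm {p : ℝ} (hp : 1 ≤ p) {f : Ω → ℝ}
    (hf : AEStronglyMeasurable f ν) :
    (∫ x, |f x| ^ p ∂ν) ^ (1 / p) = lpNorm f (ENNReal.ofReal p) ν := by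
  rw [lpNorm_eq_integral_norm_rpow_toReal _ ENNReal.ofReal_ne_top hf,
    ENNReal.toReal_ofReal (by linarith), one_div]
  · rfl
  · exact (ENNReal.ofReal_pos.2 (by linarith)).ne'

end LpNorm

section Observables

variable {X : Type*} [MetricSpace X] [MeasurableSpace X]

lemma lipschitzWith_sub_integral (μ : Measure X) {f : X → ℝ} (hf : LipschitzWith 1 f) :
    LipschitzWith 1 (fun x => f x - ∫ y, f y ∂μ) :=
  LipschitzWith.of_dist_le_mul fun x y => by simpa using hf.dist_le_mul x y

variable [BorelSpace X]

lemma integral_eq_integral_comp {Ω : Type*} [MeasurableSpace Ω] {ν : Measure Ω} {μ : Measure X}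
    {φ : Ω → X} (hφ : Measurable φ) (hν : ν.map φ = μ) {f : X → ℝ} (hf : Continuous f) :
    ∫ x, f x ∂μ = ∫ q, f (φ q) ∂ν := by
  rw [← hν, integral_map hφ.aemeasurable hf.measurable.aestronglyMeasurable]

lemma dLp_eq_lpNorm_comp {Ω : Type*} [MeasurableSpace Ω] {ν : Measure Ω} {μ : Measure X}
    {φ : Ω → X} (hφ : Measurable φ) (hν : ν.map φ = μ) {p : ℝ} (hp : 1 ≤ p) {F G : X → ℝ}
    (hF : Continuous F) (hG : Continuous G) :
    dLp μ p F G = lpNorm (fun q => F (φ q) - G (φ q)) (ENNReal.ofReal p) ν := by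
  have hc : Continuous fun x => |F x - G x| ^ p :=
    (hF.sub hG).abs.rpow_const fun _ => Or.inr (by linarith)
  rw [dLp, integral_eq_integral_comp hφ hν hc,
    integral_abs_rpow_eq_lpNorm (f := fun q => F (φ q) - G (φ q)) hp]
  exact ((hF.sub hG).measurable.comp hφ).aestronglyMeasurable

variable [CompactSpace X]

lemma LipschitzWith.memLp_comp {Ω : Type*} [MeasurableSpace Ω] {ν : Measure Ω}
    [IsFiniteMeasure ν] {φ : Ω → X} {f : X → ℝ} (hf : LipschitzWith 1 f) (hφ : Measurable φ)
    (P : ENNReal) : MemLp (fun q => f (φ q)) P ν := by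
  obtain ⟨C, hC⟩ := isCompact_univ.exists_bound_of_continuousOn hf.continuous.continuousOn
  exact MemLp.of_bound (hf.continuous.measurable.comp hφ).aestronglyMeasurable C
    (Filter.Eventually.of_forall fun q => hC (φ q) (Set.mem_univ _))

lemma integral_sub_integral_eq_zero (μ : Measure X) [IsProbabilityMeasure μ] {f : X → ℝ}
    (hf : LipschitzWith 1 f) : ∫ x, (f x - ∫ y, f y ∂μ) ∂μ = 0 := by
  have hi : Integrable f μ :=
    hf.continuous.integrable_of_hasCompactSupport (HasCompactSupport.of_compactSpace f)
  rw [integral_sub hi (integrable_const _)]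
  simp

lemma abs_le_diam_of_integral_eq_zero {μ : Measure X} [IsProbabilityMeasure μ] {F : X → ℝ}
    (hF : LipschitzWith 1 F) (h0 : ∫ x, F x ∂μ = 0) (x : X) :
    |F x| ≤ diam (Set.univ : Set X) := by
  have hi : Integrable F μ :=
    hF.continuous.integrable_of_hasCompactSupport (HasCompactSupport.of_compactSpace F)
  have h1 : F x = ∫ y, (F x - F y) ∂μ := by
    rw [integral_sub (integrable_const _) hi, h0]
    simp
  have h2 := norm_integral_le_of_norm_le_const (μ := μ) (f := fun y => F x - F y)
    (C := diam (Set.univ : Set X)) (Filter.Eventually.of_forall fun y => by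
      have hle := hF.dist_le_mul x y
      rw [NNReal.coe_one, one_mul] at hle
      exact hle.trans
        (dist_le_diam_of_mem isCompact_univ.isBounded (Set.mem_univ x) (Set.mem_univ y)))
  rw [← h1] at h2
  simpa using h2

end Observables

lemma msupport_eq_support {X : Type*} [TopologicalSpace X] [MeasurableSpace X]
    (μ : Measure X) : msupport μ = μ.support := by
  ext x
  exact (Measure.mem_support_iff_forall x).symm

/-- A 1-Lipschitz function on a subset of one side of a pseudometric gluing extends to a function
that is 1-Lipschitz for the gluing, and agrees with a 1-Lipschitz function on the other side. -/
lemma exists_lipschitz_extension_of_gluing {X Y Z : Type*} [MetricSpace X] [MetricSpace Y]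
    {δ : Z → Z → ℝ} (h0 : ∀ z, δ z z = 0) (hs : ∀ z w, δ z w = δ w z)
    (ht : ∀ z w u, δ z u ≤ δ z w + δ w u) {i : X → Z} {j : Y → Z} {K : Set X} {K' : Set Y}
    (hi : ∀ x ∈ K, ∀ y ∈ K, δ (i x) (i y) = dist x y)
    (hj : ∀ x ∈ K', ∀ y ∈ K', δ (j x) (j y) = dist x y)
    {F : X → ℝ} (hF : LipschitzWith 1 F) :
    ∃ (g : Z → ℝ) (F' : Y → ℝ), (∀ z w, |g z - g w| ≤ δ z w) ∧ (∀ x ∈ K, g (i x) = F x) ∧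
      LipschitzWith 1 F' ∧ ∀ y ∈ K', g (j y) = F' y := by
  let _ : PseudoMetricSpace Z :=
    { dist := δ
      dist_self := h0
      dist_comm := hs
      dist_triangle := ht }
  have hd : ∀ z w : Z, dist z w = δ z w := fun _ _ => rfl
  have hwell : ∀ x ∈ K, ∀ y ∈ K, i x = i y → x = y := fun x hx y hy h => by
    rw [← dist_eq_zero, ← hi x hx y hy, h, h0]
  classical
  let G : Z → ℝ := fun z => if h : ∃ x ∈ K, i x = z then F h.choose else 0
  have hG : ∀ x ∈ K, G (i x) = F x := fun x hx => by
    have h : ∃ y ∈ K, i y = i x := ⟨x, hx, rfl⟩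
    simp only [G, dif_pos h]
    rw [hwell _ h.choose_spec.1 _ hx h.choose_spec.2]
  obtain ⟨g, hg, hgG⟩ := LipschitzOnWith.extend_real (f := G) (s := i '' K) (K := 1) (by
    refine LipschitzOnWith.of_dist_le_mul ?_
    rintro _ ⟨x, hx, rfl⟩ _ ⟨y, hy, rfl⟩
    rw [hG x hx, hG y hy, hd, hi x hx y hy]
    exact hF.dist_le_mul x y)
  obtain ⟨F', hF', hgF'⟩ := LipschitzOnWith.extend_real (f := fun y => g (j y))
      (s := K') (K := 1) (by
    refine LipschitzOnWith.of_dist_le_mul fun x hx y hy => ?_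
    rw [← hj x hx y hy]
    exact hg.dist_le_mul _ _)
  refine ⟨g, F', fun z w => ?_, fun x hx => ?_, hF', hgF'⟩
  · simpa [Real.dist_eq, hd] using hg.dist_le_mul z w
  · rw [← hgG ⟨x, hx, rfl⟩, hG x hx]

section Coupling

variable {X X' : Type*} [MetricSpace X] [MeasurableSpace X] [MetricSpace X'] [MeasurableSpace X']
  {μ : Measure X} {μ' : Measure X'} {δ : X ⊕ X' → X ⊕ X' → ℝ}

lemma MetricCoupling.nonneg (hδ : MetricCoupling μ μ' δ) (z w : X ⊕ X') : 0 ≤ δ z w := by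
  obtain ⟨h0, hs, ht, -⟩ := hδ
  have := ht z w z
  rw [h0, hs w z] at this
  linarith

lemma exists_right_mem_Sdelta [CompactSpace X'] [BorelSpace X'] [IsProbabilityMeasure μ']
    (hδ : MetricCoupling μ μ' δ) (F : Obsc X μ) : ∃ F' : Obsc X' μ', (F.1, F'.1) ∈ Sdelta μ μ' δ := by
  obtain ⟨h0, hs, ht, -, hK, hK'⟩ := hδ
  obtain ⟨g, f', hg, hgF, hf', hgf'⟩ :=
    exists_lipschitz_extension_of_gluing h0 hs ht hK hK' F.2.1
  refine ⟨⟨_, lipschitzWith_sub_integral μ' hf', integral_sub_integral_eq_zero μ' hf'⟩,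
    F.1, f', F.2.1, hf', ?_, by simp [F.2.2], rfl⟩
  have key : ∀ z ∈ Sum.inl '' msupport μ ∪ Sum.inr '' msupport μ', Sum.elim F.1 f' z = g z := by
    rintro _ (⟨x, hx, rfl⟩ | ⟨x, hx, rfl⟩)
    · exact (hgF x hx).symm
    · exact (hgf' x hx).symm
  intro z hz w hw
  rw [key z hz, key w hw]
  exact hg z w

lemma exists_left_mem_Sdelta [CompactSpace X] [BorelSpace X] [IsProbabilityMeasure μ]
    (hδ : MetricCoupling μ μ' δ) (F' : Obsc X' μ') : ∃ F : Obsc X μ, (F.1, F'.1) ∈ Sdelta μ μ' δ := by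
  obtain ⟨h0, hs, ht, -, hK, hK'⟩ := hδ
  obtain ⟨g, f, hg, hgF, hf, hgf⟩ :=
    exists_lipschitz_extension_of_gluing h0 hs ht hK' hK F'.2.1
  refine ⟨⟨_, lipschitzWith_sub_integral μ hf, integral_sub_integral_eq_zero μ hf⟩,
    f, F'.1, hf, F'.2.1, ?_, rfl, by simp [F'.2.2]⟩
  have key : ∀ z ∈ Sum.inl '' msupport μ ∪ Sum.inr '' msupport μ', Sum.elim f F'.1 z = g z := by
    rintro _ (⟨x, hx, rfl⟩ | ⟨x, hx, rfl⟩)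
    · exact (hgf x hx).symm
    · exact (hgF x hx).symm
  intro z hz w hw
  rw [key z hz, key w hw]
  exact hg z w

variable [CompactSpace X] [CompactSpace X'] {h : Measure (X × X')}

lemma ae_mem_msupport_prod (h1 : h.map Prod.fst = μ) (h2 : h.map Prod.snd = μ') :
    ∀ᵐ q ∂h, q ∈ msupport μ ×ˢ msupport μ' := by
  have ha : ∀ᵐ q ∂h, q.1 ∈ msupport μ := by
    rw [msupport_eq_support]
    refine ae_of_ae_map (f := Prod.fst) (p := fun x => x ∈ μ.support)
      measurable_fst.aemeasurable ?_
    rw [h1]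
    exact Measure.support_mem_ae
  have hb : ∀ᵐ q ∂h, q.2 ∈ msupport μ' := by
    rw [msupport_eq_support]
    refine ae_of_ae_map (f := Prod.snd) (p := fun x => x ∈ μ'.support)
      measurable_snd.aemeasurable ?_
    rw [h2]
    exact Measure.support_mem_ae
  filter_upwards [ha, hb] with q hq hq' using ⟨hq, hq'⟩

variable [BorelSpace X] [BorelSpace X']

lemma MetricCoupling.memLp [IsProbabilityMeasure h] (hδ : MetricCoupling μ μ' δ)
    (h1 : h.map Prod.fst = μ) (h2 : h.map Prod.snd = μ') (P : ENNReal) :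
    MemLp (fun q : X × X' => δ (Sum.inl q.1) (Sum.inr q.2)) P h := by
  have hmem := ae_mem_msupport_prod h1 h2
  have hcl : IsClosed (msupport μ ×ˢ msupport μ') := by
    rw [msupport_eq_support, msupport_eq_support]
    exact Measure.isClosed_support.prod Measure.isClosed_support
  have hc : ContinuousOn (fun q : X × X' => δ (Sum.inl q.1) (Sum.inr q.2))
      (msupport μ ×ˢ msupport μ') := by
    refine (LipschitzOnWith.of_dist_le_mul (K := 2) fun a ha b hb => ?_).continuousOn
    obtain ⟨-, hs, ht, -, hK, hK'⟩ := hδ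
    have e1 := hK _ ha.1 _ hb.1
    have e2 := hK' _ ha.2 _ hb.2
    have l1 : dist a.1 b.1 ≤ dist a b := le_max_left _ _
    have l2 : dist a.2 b.2 ≤ dist a b := le_max_right _ _
    have t1 := ht (Sum.inl a.1) (Sum.inl b.1) (Sum.inr a.2)
    have t2 := ht (Sum.inl b.1) (Sum.inr b.2) (Sum.inr a.2)
    have t3 := ht (Sum.inl b.1) (Sum.inl a.1) (Sum.inr b.2)
    have t4 := ht (Sum.inl a.1) (Sum.inr a.2) (Sum.inr b.2)
    have s1 := hs (Sum.inl a.1) (Sum.inl b.1)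
    have s2 := hs (Sum.inr a.2) (Sum.inr b.2)
    rw [Real.dist_eq, NNReal.coe_ofNat, abs_le]
    constructor <;> linarith
  obtain ⟨C, hC⟩ := hcl.isCompact.exists_bound_of_continuousOn hc
  refine MemLp.of_bound ?_ C (hmem.mono hC)
  rw [← Measure.restrict_eq_self_of_ae_mem hmem]
  exact hc.aestronglyMeasurable hcl.measurableSet

lemma integral_delta_rpow_eq_lpNorm [IsProbabilityMeasure h] (hδ : MetricCoupling μ μ' δ)
    (h1 : h.map Prod.fst = μ) (h2 : h.map Prod.snd = μ') {p : ℝ} (hp : 1 ≤ p) :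
    (∫ q : X × X', δ (Sum.inl q.1) (Sum.inr q.2) ^ p ∂h) ^ (1 / p) =
      lpNorm (fun q : X × X' => δ (Sum.inl q.1) (Sum.inr q.2)) (ENNReal.ofReal p) h := by
  rw [← integral_abs_rpow_eq_lpNorm hp (hδ.memLp h1 h2 1).aestronglyMeasurable]
  simp_rw [abs_of_nonneg (hδ.nonneg _ _)]

lemma lpNorm_sub_le_of_mem_Sdelta [IsProbabilityMeasure h] (hδ : MetricCoupling μ μ' δ)
    (h1 : h.map Prod.fst = μ) (h2 : h.map Prod.snd = μ') {P : ENNReal} (hP : 1 ≤ P)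
    {F : X → ℝ} {F' : X' → ℝ} (hS : (F, F') ∈ Sdelta μ μ' δ) :
    lpNorm (fun q : X × X' => F q.1 - F' q.2) P h ≤
      2 * lpNorm (fun q : X × X' => δ (Sum.inl q.1) (Sum.inr q.2)) P h := by
  obtain ⟨f, f', hf, hf', hff', hF, hF'⟩ := hS
  dsimp only at hF hF'
  subst hF hF'
  have hm : MemLp (fun q : X × X' => f q.1 - f' q.2) P h :=
    (hf.memLp_comp measurable_fst P).sub (hf'.memLp_comp measurable_snd P)
  have hle : ∀ᵐ q ∂h, |f q.1 - f' q.2| ≤ δ (Sum.inl q.1) (Sum.inr q.2) := by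
    filter_upwards [ae_mem_msupport_prod h1 h2] with q hq
    exact hff' (Sum.inl q.1) (Or.inl ⟨_, hq.1, rfl⟩) (Sum.inr q.2) (Or.inr ⟨_, hq.2, rfl⟩)
  have heq : (fun q : X × X' => (f q.1 - ∫ y, f y ∂μ) - (f' q.2 - ∫ y, f' y ∂μ')) =
      fun q => (f q.1 - f' q.2) - ∫ r : X × X', (f r.1 - f' r.2) ∂h := by
    funext q
    rw [integral_sub ((hf.memLp_comp measurable_fst 1).integrable le_rfl)
      ((hf'.memLp_comp measurable_snd 1).integrable le_rfl),
      integral_eq_integral_comp measurable_fst h1 hf.continuous,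
      integral_eq_integral_comp measurable_snd h2 hf'.continuous]
    ring
  rw [heq]
  exact (lpNorm_sub_integral_le hP hm).trans
    (mul_le_mul_of_nonneg_left (lpNorm_mono_ae_real (hδ.memLp h1 h2 P) hle) (by norm_num))

lemma abs_dLp_sub_dLp_le_of_mem_Sdelta [IsProbabilityMeasure h] (hδ : MetricCoupling μ μ' δ)
    (h1 : h.map Prod.fst = μ) (h2 : h.map Prod.snd = μ') {p : ℝ} (hp : 1 ≤ p)
    {F G : X → ℝ} {F' G' : X' → ℝ} (hF : LipschitzWith 1 F) (hG : LipschitzWith 1 G)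
    (hF' : LipschitzWith 1 F') (hG' : LipschitzWith 1 G')
    (hSF : (F, F') ∈ Sdelta μ μ' δ) (hSG : (G, G') ∈ Sdelta μ μ' δ) :
    |dLp μ p F G - dLp μ' p F' G'| ≤
      4 * (∫ q : X × X', δ (Sum.inl q.1) (Sum.inr q.2) ^ p ∂h) ^ (1 / p) := by
  have hP : 1 ≤ ENNReal.ofReal p := by simpa using hp
  rw [dLp_eq_lpNorm_comp measurable_fst h1 hp hF.continuous hG.continuous,
    dLp_eq_lpNorm_comp measurable_snd h2 hp hF'.continuous hG'.continuous,
    integral_delta_rpow_eq_lpNorm hδ h1 h2 hp]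
  set P := ENNReal.ofReal p
  have bF := lpNorm_sub_le_of_mem_Sdelta hδ h1 h2 hP hSF
  have bG := lpNorm_sub_le_of_mem_Sdelta hδ h1 h2 hP hSG
  have m1 : MemLp (fun q : X × X' => F q.1 - G q.1) P h :=
    (hF.memLp_comp measurable_fst P).sub (hG.memLp_comp measurable_fst P)
  have m2 : MemLp (fun q : X × X' => F' q.2 - G' q.2) P h :=
    (hF'.memLp_comp measurable_snd P).sub (hG'.memLp_comp measurable_snd P)
  have m3 : MemLp (fun q : X × X' => F q.1 - F' q.2) P h :=
    (hF.memLp_comp measurable_fst P).sub (hF'.memLp_comp measurable_snd P)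
  have e : ((fun q : X × X' => F q.1 - G q.1) - fun q => F' q.2 - G' q.2) =
      (fun q : X × X' => F q.1 - F' q.2) - fun q => G q.1 - G' q.2 := by
    funext q
    simp only [Pi.sub_apply]
    ring
  have k := lpNorm_sub_le m3 hP (g := fun q : X × X' => G q.1 - G' q.2)
  rw [← e] at k
  have k1 := lpNorm_le_lpNorm_add_lpNorm_sub' m2 hP (f := fun q : X × X' => F q.1 - G q.1)
  have k2 := lpNorm_le_lpNorm_add_lpNorm_sub m1 hP (f := fun q : X × X' => F' q.2 - G' q.2)
  rw [abs_le]
  constructor <;> linarith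

lemma abs_covariance_sub_le_of_mem_Sdelta [IsProbabilityMeasure μ] [IsProbabilityMeasure μ']
    [IsProbabilityMeasure h] (hδ : MetricCoupling μ μ' δ)
    (h1 : h.map Prod.fst = μ) (h2 : h.map Prod.snd = μ') {p : ℝ} (hp : 1 ≤ p)
    (F G : Obsc X μ) (F' G' : Obsc X' μ')
    (hSF : (F.1, F'.1) ∈ Sdelta μ μ' δ) (hSG : (G.1, G'.1) ∈ Sdelta μ μ' δ) :
    |(∫ x, F.1 x * G.1 x ∂μ) - ∫ x, F'.1 x * G'.1 x ∂μ'| ≤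
      2 * (diam (Set.univ : Set X) + diam (Set.univ : Set X')) *
        (∫ q : X × X', δ (Sum.inl q.1) (Sum.inr q.2) ^ p ∂h) ^ (1 / p) := by
  obtain ⟨F, hF, hF0⟩ := F
  obtain ⟨G, hG, hG0⟩ := G
  obtain ⟨F', hF', hF0'⟩ := F'
  obtain ⟨G', hG', hG0'⟩ := G'
  dsimp only at hSF hSG ⊢
  have hP : 1 ≤ ENNReal.ofReal p := by simpa using hp
  rw [integral_eq_integral_comp measurable_fst h1
      (f := fun x => F x * G x) (hF.continuous.mul hG.continuous),
    integral_eq_integral_comp measurable_snd h2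
      (f := fun x => F' x * G' x) (hF'.continuous.mul hG'.continuous),
    integral_delta_rpow_eq_lpNorm hδ h1 h2 hp]
  set P := ENNReal.ofReal p
  set D := diam (Set.univ : Set X)
  set D' := diam (Set.univ : Set X')
  have mF : MemLp (fun q : X × X' => F q.1 - F' q.2) P h :=
    (hF.memLp_comp measurable_fst P).sub (hF'.memLp_comp measurable_snd P)
  have mG : MemLp (fun q : X × X' => G q.1 - G' q.2) P h :=
    (hG.memLp_comp measurable_fst P).sub (hG'.memLp_comp measurable_snd P)
  have bF := (integral_abs_le_lpNorm hP mF).trans (lpNorm_sub_le_of_mem_Sdelta hδ h1 h2 hP hSF)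
  have bG := (integral_abs_le_lpNorm hP mG).trans (lpNorm_sub_le_of_mem_Sdelta hδ h1 h2 hP hSG)
  have iFG : Integrable (fun q : X × X' => F q.1 * G q.1) h :=
    (hF.memLp_comp measurable_fst 2).integrable_mul (hG.memLp_comp measurable_fst 2)
  have iFG' : Integrable (fun q : X × X' => F' q.2 * G' q.2) h :=
    (hF'.memLp_comp measurable_snd 2).integrable_mul (hG'.memLp_comp measurable_snd 2)
  have iF := (mF.integrable hP).abs.const_mul D'
  have iG := (mG.integrable hP).abs.const_mul D
  have hD : 0 ≤ D := diam_nonneg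
  have hD' : 0 ≤ D' := diam_nonneg
  rw [← integral_sub iFG iFG']
  calc |∫ q : X × X', (F q.1 * G q.1 - F' q.2 * G' q.2) ∂h|
      ≤ ∫ q : X × X', |F q.1 * G q.1 - F' q.2 * G' q.2| ∂h := abs_integral_le_integral_abs
    _ ≤ ∫ q : X × X', (D * |G q.1 - G' q.2| + D' * |F q.1 - F' q.2|) ∂h := by
        refine integral_mono (iFG.sub iFG').abs (iG.add iF) fun q => ?_
        dsimp only
        have e : F q.1 * G q.1 - F' q.2 * G' q.2 =
            F q.1 * (G q.1 - G' q.2) + G' q.2 * (F q.1 - F' q.2) := by ring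
        rw [e]
        refine (abs_add_le _ _).trans ?_
        rw [abs_mul, abs_mul]
        exact add_le_add
          (mul_le_mul_of_nonneg_right (abs_le_diam_of_integral_eq_zero hF hF0 _) (abs_nonneg _))
          (mul_le_mul_of_nonneg_right (abs_le_diam_of_integral_eq_zero hG' hG0' _) (abs_nonneg _))
    _ = D * (∫ q : X × X', |G q.1 - G' q.2| ∂h) + D' * ∫ q : X × X', |F q.1 - F' q.2| ∂h := by
        rw [integral_add iG iF, integral_const_mul, integral_const_mul]
    _ ≤ D * (2 * lpNorm (fun q : X × X' => δ (Sum.inl q.1) (Sum.inr q.2)) P h) +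
        D' * (2 * lpNorm (fun q : X × X' => δ (Sum.inl q.1) (Sum.inr q.2)) P h) :=
        add_le_add (mul_le_mul_of_nonneg_left bG hD) (mul_le_mul_of_nonneg_left bF hD')
    _ = _ := by ring

lemma isCorrespondence_Sdelta_prod [IsProbabilityMeasure μ] [IsProbabilityMeasure μ']
    (hδ : MetricCoupling μ μ' δ) :
    IsCorrespondence {q : (Obsc X μ × Obsc X μ) × (Obsc X' μ' × Obsc X' μ') |
      (q.1.1.1, q.2.1.1) ∈ Sdelta μ μ' δ ∧ (q.1.2.1, q.2.2.1) ∈ Sdelta μ μ' δ} := by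
  constructor
  · rintro ⟨F, G⟩
    obtain ⟨F', hF⟩ := exists_right_mem_Sdelta hδ F
    obtain ⟨G', hG⟩ := exists_right_mem_Sdelta hδ G
    exact ⟨(F', G'), hF, hG⟩
  · rintro ⟨F', G'⟩
    obtain ⟨F, hF⟩ := exists_left_mem_Sdelta hδ F'
    obtain ⟨G, hG⟩ := exists_left_mem_Sdelta hδ G'
    exact ⟨(F, G), hF, hG⟩

end Coupling

lemma funGH_le_of_distortion_le {α β : Type*} {D : α → α → ℝ} {D' : β → β → ℝ}
    {φ : α → ℝ} {ψ : β → ℝ} {R : Set (α × β)} (hR : IsCorrespondence R) {c I : ℝ} (hI : 0 ≤ I)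
    (h1 : relDistortion D D' R ≤ ENNReal.ofReal (4 * I))
    (h2 : relFunDistortion φ ψ R ≤ ENNReal.ofReal (c * I)) :
    funGH D D' φ ψ ≤ ENNReal.ofReal (max 2 c) * ENNReal.ofReal I := by
  have h3 : max (relDistortion D D' R) (2 * relFunDistortion φ ψ R) ≤
      2 * ENNReal.ofReal (max 2 c * I) := by
    have e : (2 : ENNReal) = ENNReal.ofReal 2 := by simp
    refine max_le (h1.trans ?_) (mul_le_mul_right (h2.trans ?_) 2)
    · rw [e, ← ENNReal.ofReal_mul (by norm_num)]
      refine ENNReal.ofReal_le_ofReal ?_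
      nlinarith [mul_le_mul_of_nonneg_right (le_max_left 2 c) hI]
    · exact ENNReal.ofReal_le_ofReal (mul_le_mul_of_nonneg_right (le_max_right 2 c) hI)
  rw [← ENNReal.ofReal_mul (by positivity)]
  calc funGH D D' φ ψ ≤ (1 / 2) * (2 * ENNReal.ofReal (max 2 c * I)) :=
        mul_le_mul_right ((iInf₂_le R hR).trans h3) _
    _ = ENNReal.ofReal (max 2 c * I) := by
        rw [← mul_assoc, one_div, ENNReal.inv_mul_cancel two_ne_zero ENNReal.ofNat_ne_top, one_mul]

/-- Heterogeneous stability of the observable covariance. For every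
metric coupling `δ` and probabilistic coupling `h`, the product correspondence
`Ŝ_δ = S_δ × S_δ` between `Obs_c(μ)²` and `Obs_c(μ')²` has structural distortion
(for the max product `L_p` pseudometrics) at most `4 (∫ δ^p dh)^{1/p}` and
functional distortion (for the covariances `Σ_μ, Σ_{μ'}`) at most
`2 (D_X + D_{X'}) (∫ δ^p dh)^{1/p}`; consequently the Gromov–Hausdorff distance of
`(Obs_c(μ)², Σ_μ)` and `(Obs_c(μ')², Σ_{μ'})` is at most
`max{2, 2(D_X + D_{X'})} · d_{KS,p}(μ, μ')`. -/
theorem observable_covariance_heterogeneous_stability {X X' : Type*}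
    [MetricSpace X] [CompactSpace X] [MeasurableSpace X] [BorelSpace X]
    [MetricSpace X'] [CompactSpace X'] [MeasurableSpace X'] [BorelSpace X']
    (μ : Measure X) [IsProbabilityMeasure μ] (μ' : Measure X') [IsProbabilityMeasure μ']
    (p : ℝ) (hp : 1 ≤ p) :
    (∀ δ : X ⊕ X' → X ⊕ X' → ℝ, MetricCoupling μ μ' δ →
      ∀ h : Measure (X × X'), IsProbabilityMeasure h →
        h.map Prod.fst = μ → h.map Prod.snd = μ' →
        relDistortion
            (fun P Q : Obsc X μ × Obsc X μ =>
              max (dLp μ p P.1.1 Q.1.1) (dLp μ p P.2.1 Q.2.1))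
            (fun P Q : Obsc X' μ' × Obsc X' μ' =>
              max (dLp μ' p P.1.1 Q.1.1) (dLp μ' p P.2.1 Q.2.1))
            {q | (q.1.1.1, q.2.1.1) ∈ Sdelta μ μ' δ ∧
              (q.1.2.1, q.2.2.1) ∈ Sdelta μ μ' δ} ≤
          ENNReal.ofReal
            (4 * (∫ q : X × X', δ (Sum.inl q.1) (Sum.inr q.2) ^ p ∂h) ^ (1 / p)) ∧
        relFunDistortion
            (fun P : Obsc X μ × Obsc X μ => ∫ x, P.1.1 x * P.2.1 x ∂μ)
            (fun P : Obsc X' μ' × Obsc X' μ' => ∫ x, P.1.1 x * P.2.1 x ∂μ')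
            {q | (q.1.1.1, q.2.1.1) ∈ Sdelta μ μ' δ ∧
              (q.1.2.1, q.2.2.1) ∈ Sdelta μ μ' δ} ≤
          ENNReal.ofReal
            (2 * (diam (Set.univ : Set X) + diam (Set.univ : Set X')) *
              (∫ q : X × X', δ (Sum.inl q.1) (Sum.inr q.2) ^ p ∂h) ^ (1 / p))) ∧
    funGH
        (fun P Q : Obsc X μ × Obsc X μ =>
          max (dLp μ p P.1.1 Q.1.1) (dLp μ p P.2.1 Q.2.1))
        (fun P Q : Obsc X' μ' × Obsc X' μ' =>
          max (dLp μ' p P.1.1 Q.1.1) (dLp μ' p P.2.1 Q.2.1))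
        (fun P => ∫ x, P.1.1 x * P.2.1 x ∂μ)
        (fun P => ∫ x, P.1.1 x * P.2.1 x ∂μ') ≤
      ENNReal.ofReal
          (max 2 (2 * (diam (Set.univ : Set X) + diam (Set.univ : Set X')))) *
        dKS μ μ' p := by
  refine (fun hmain => ⟨hmain, ?_⟩) ?_
  · intro δ hδ h _ h1 h2
    refine ⟨iSup₂_le fun q hq => iSup₂_le fun r hr => ENNReal.ofReal_le_ofReal ?_,
      iSup₂_le fun q hq => ENNReal.ofReal_le_ofReal ?_⟩
    · refine (abs_max_sub_max_le_max _ _ _ _).trans (max_le ?_ ?_)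
      · exact abs_dLp_sub_dLp_le_of_mem_Sdelta hδ h1 h2 hp q.1.1.2.1 r.1.1.2.1 q.2.1.2.1
          r.2.1.2.1 hq.1 hr.1
      · exact abs_dLp_sub_dLp_le_of_mem_Sdelta hδ h1 h2 hp q.1.2.2.1 r.1.2.2.1 q.2.2.2.1
          r.2.2.2.1 hq.2 hr.2
    · exact abs_covariance_sub_le_of_mem_Sdelta hδ h1 h2 hp _ _ _ _ hq.1 hq.2
  · have hc : ENNReal.ofReal
        (max 2 (2 * (diam (Set.univ : Set X) + diam (Set.univ : Set X')))) ≠ 0 :=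
      (ENNReal.ofReal_pos.2 (by positivity)).ne'
    rw [← ENNReal.div_le_iff' hc ENNReal.ofReal_ne_top, dKS]
    refine le_iInf₂ fun δ hδ => le_iInf₂ fun h hh => ?_
    obtain ⟨hprob, h1, h2⟩ := hh
    rw [ENNReal.div_le_iff' hc ENNReal.ofReal_ne_top]
    obtain ⟨hdis, hfdis⟩ := hmain δ hδ h hprob h1 h2
    refine funGH_le_of_distortion_le (isCorrespondence_Sdelta_prod hδ) ?_ hdis hfdis
    rw [integral_delta_rpow_eq_lpNorm hδ h1 h2 hp]
    exact lpNorm_nonneg
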